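/- Let G = (V,E) be a graph, let t ≥ 1, and let 𝓗 be a vertex-disjoint packing of induced subgraphs of G with 1 ≤ τ(H) ≤ t for every H ∈ 𝓗, such that for no H = (W,F) ∈ 𝓗 does there exist a cluster editing set S for H with |S| = τ(H) satisfying: for all u, v ∈ W in the same cluster of H △ S, N_G(u) ∖ W = N_G(v) ∖ W, and for all u, v ∈ W in different clusters of H △ S, N_G(u) ∩ N_G(v) ⊆ W. If G has a cluster editing set of size at most k, then k ≤ (2t+1)·(k − h(𝓗)), where h(𝓗) := Σ_{H∈𝓗} τ(H). -/

import Mathlib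

open SimpleGraph

/-- The graph obtained from `G` by applying the edge modification set `S`. -/
def editEdges {V : Type*} (G : SimpleGraph V) (S : Set (Sym2 V)) : SimpleGraph V :=
  SimpleGraph.fromEdgeSet (symmDiff G.edgeSet S)

/-- A cluster graph: a disjoint union of cliques, equivalently a `P₃`-free graph. -/
def IsClusterGraph {V : Type*} (G : SimpleGraph V) : Prop :=
  ∀ u v w : V, G.Adj u v → G.Adj v w → u ≠ w → G.Adj u w

/-- `S` is a cluster editing set for `G`. -/
def IsClusterEditingSet {V : Type*} (G : SimpleGraph V) (S : Finset (Sym2 V)) : Prop :=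
  (∀ e ∈ S, ¬ e.IsDiag) ∧ IsClusterGraph (editEdges G ↑S)

/-- `τ` of the subgraph of `G` induced by `W`. -/
noncomputable def clusterEditNumOn {V : Type*} [Fintype V] [DecidableEq V]
    (G : SimpleGraph V) (W : Finset V) : ℕ :=
  sInf {n | ∃ S : Finset (Sym2 V), (∀ e ∈ S, ¬ e.IsDiag) ∧
    (∀ e ∈ S, ∀ v ∈ e, v ∈ W) ∧ S.card = n ∧
    IsClusterGraph ((editEdges G ↑S).induce (W : Set V))}

theorem editEdges_adj {V : Type*} (G : SimpleGraph V) (S : Set (Sym2 V)) (u v : V) :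
    (editEdges G S).Adj u v ↔
      (G.Adj u v ∧ s(u, v) ∉ S ∨ s(u, v) ∈ S ∧ ¬ G.Adj u v) ∧ u ≠ v := by
  simp [editEdges, Set.mem_symmDiff]

theorem editEdges_adj_of_notMem {V : Type*} {G : SimpleGraph V} {S : Set (Sym2 V)} {u v : V}
    (h : s(u, v) ∉ S) : (editEdges G S).Adj u v ↔ G.Adj u v := by
  rw [editEdges_adj]
  exact ⟨by tauto, fun hG => ⟨Or.inl ⟨hG, h⟩, hG.ne⟩⟩

theorem induce_editEdges_filter {V : Type*} (G : SimpleGraph V)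
    (S : Finset (Sym2 V)) (W : Finset V)
    [DecidablePred fun e : Sym2 V => ∀ v ∈ e, v ∈ W] :
    (editEdges G ↑(S.filter fun e => ∀ v ∈ e, v ∈ W)).induce (W : Set V) =
      (editEdges G ↑S).induce (W : Set V) := by
  ext ⟨u, hu⟩ ⟨v, hv⟩
  have hu' : u ∈ W := hu
  have hv' : v ∈ W := hv
  simp [editEdges_adj, hu', hv']

theorem IsClusterGraph.induce {V : Type*} {G : SimpleGraph V} (hG : IsClusterGraph G)
    (s : Set V) : IsClusterGraph (G.induce s) := by
  intro u v w huv hvw huw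
  exact hG u v w huv hvw fun h => huw (Subtype.ext h)

theorem IsClusterGraph.eq_or_adj_of_reachable {V : Type*} {G : SimpleGraph V}
    (hG : IsClusterGraph G) {u v : V} (h : G.Reachable u v) : u = v ∨ G.Adj u v := by
  obtain ⟨p⟩ := h
  induction p with
  | nil => exact Or.inl rfl
  | @cons a b c hab _ ih =>
    rcases ih with rfl | hbc
    · exact Or.inr hab
    · by_cases hac : a = c
      · exact Or.inl hac
      · exact Or.inr (hG a b c hab hbc hac)

/-- The two conditions of the reduction rule for `W` hold once the cluster editing set `S`
contains no pair with exactly one endpoint in `W`. -/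
theorem IsClusterGraph.neighborSet_conditions {V : Type*} {G : SimpleGraph V}
    {S : Set (Sym2 V)} (hS : IsClusterGraph (editEdges G S)) {W : Set V}
    (hcross : ∀ u ∈ W, ∀ x ∉ W, s(u, x) ∉ S) :
    (∀ (u : V) (hu : u ∈ W) (v : V) (hv : v ∈ W),
      ((editEdges G S).induce W).Reachable ⟨u, hu⟩ ⟨v, hv⟩ →
        G.neighborSet u \ W = G.neighborSet v \ W) ∧
    (∀ (u : V) (hu : u ∈ W) (v : V) (hv : v ∈ W),
      ¬ ((editEdges G S).induce W).Reachable ⟨u, hu⟩ ⟨v, hv⟩ →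
        G.neighborSet u ∩ G.neighborSet v ⊆ W) := by
  have hadj : ∀ u ∈ W, ∀ x ∉ W, ((editEdges G S).Adj u x ↔ G.Adj u x) :=
    fun u hu x hx => editEdges_adj_of_notMem (hcross u hu x hx)
  constructor
  · have hsub : ∀ (u : V) (hu : u ∈ W) (v : V) (hv : v ∈ W),
        ((editEdges G S).induce W).Reachable ⟨u, hu⟩ ⟨v, hv⟩ →
          G.neighborSet u \ W ⊆ G.neighborSet v \ W := by
      rintro u hu v hv huv x ⟨hux, hx⟩
      refine ⟨?_, hx⟩
      rcases (hS.induce W).eq_or_adj_of_reachable huv with h | h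
      · obtain rfl : u = v := congrArg Subtype.val h
        exact hux
      · have hvx : v ≠ x := fun h => hx (h ▸ hv)
        have huv' : (editEdges G S).Adj u v := h
        exact (hadj v hv x hx).1 (hS v u x huv'.symm ((hadj u hu x hx).2 hux) hvx)
    exact fun u hu v hv huv => (hsub u hu v hv huv).antisymm (hsub v hv u hu huv.symm)
  · rintro u hu v hv huv x ⟨hux, hvx⟩
    by_contra hx
    by_cases h : u = v
    · subst h
      exact huv (Reachable.refl _)
    · have huv' : (editEdges G S).Adj u v :=
        hS u x v ((hadj u hu x hx).2 hux) ((hadj v hv x hx).2 hvx).symm h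
      exact huv (Adj.reachable (G := (editEdges G S).induce W) huv')

theorem clusterEditNumOn_le {V : Type*} [Fintype V] [DecidableEq V] {G : SimpleGraph V}
    {S : Finset (Sym2 V)} (hS : IsClusterEditingSet G S) (W : Finset V)
    [DecidablePred fun e : Sym2 V => ∀ v ∈ e, v ∈ W] :
    clusterEditNumOn G W ≤ (S.filter fun e => ∀ v ∈ e, v ∈ W).card := by
  refine Nat.sInf_le ⟨_, fun e he => hS.1 e (Finset.mem_filter.1 he).1,
    fun e he => (Finset.mem_filter.1 he).2, rfl, ?_⟩
  rw [induce_editEdges_filter]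
  exact hS.2.induce _

theorem two_mul_card_filter_add_card_filter_le {V : Type*} [DecidableEq V]
    {S : Finset (Sym2 V)} (hS : ∀ e ∈ S, ¬ e.IsDiag) (W : Finset V)
    [DecidablePred fun e : Sym2 V => ∀ v ∈ e, v ∈ W]
    [DecidablePred fun e : Sym2 V => (∃ v ∈ e, v ∈ W) ∧ ∃ v ∈ e, v ∉ W] :
    2 * (S.filter fun e => ∀ v ∈ e, v ∈ W).card +
        (S.filter fun e => (∃ v ∈ e, v ∈ W) ∧ ∃ v ∈ e, v ∉ W).card ≤
      ∑ e ∈ S, (e.toFinset ∩ W).card := by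
  rw [Finset.card_filter, Finset.card_filter, Finset.mul_sum, ← Finset.sum_add_distrib]
  refine Finset.sum_le_sum fun e he => ?_
  have hcard := Sym2.card_toFinset_of_not_isDiag e (hS e he)
  by_cases hin : ∀ v ∈ e, v ∈ W
  · have hsub : e.toFinset ⊆ W := fun v hv => hin v (Sym2.mem_toFinset.1 hv)
    have hnot : ¬ ((∃ v ∈ e, v ∈ W) ∧ ∃ v ∈ e, v ∉ W) :=
      fun ⟨_, v, hv, hvW⟩ => hvW (hin v hv)
    rw [if_pos hin, if_neg hnot, Finset.inter_eq_left.2 hsub, hcard, mul_one, add_zero]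
  · rw [if_neg hin]
    split_ifs with h
    · obtain ⟨⟨v, hv, hvW⟩, -⟩ := h
      simpa using Finset.card_pos.2
        ⟨v, Finset.mem_inter.2 ⟨Sym2.mem_toFinset.2 hv, hvW⟩⟩
    · simp

theorem sum_sum_card_toFinset_inter_le {V : Type*} [DecidableEq V] {S : Finset (Sym2 V)}
    {P : Finset (Finset V)}
    (hP : ∀ W₁ ∈ P, ∀ W₂ ∈ P, W₁ ≠ W₂ → Disjoint W₁ W₂) :
    ∑ W ∈ P, ∑ e ∈ S, (e.toFinset ∩ W).card ≤ 2 * S.card := by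
  rw [Finset.sum_comm, mul_comm, ← smul_eq_mul]
  refine Finset.sum_le_card_nsmul _ _ _ fun e _ => ?_
  rw [← Finset.card_biUnion fun W₁ h₁ W₂ h₂ hne =>
    (hP W₁ h₁ W₂ h₂ hne).mono Finset.inter_subset_right Finset.inter_subset_right]
  calc (P.biUnion fun W => e.toFinset ∩ W).card ≤ e.toFinset.card :=
        Finset.card_le_card (Finset.biUnion_subset.2 fun W _ => Finset.inter_subset_left)
    _ ≤ 2 := by
        rw [Sym2.card_toFinset]
        split_ifs <;> omega

/-- Lemma 9 of the paper. Let `𝓗` be a vertex-disjoint packing of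
induced subgraphs of `G` with `1 ≤ τ(H) ≤ t` for each `H ∈ 𝓗` such that Rule 3 is
inapplicable to every `H ∈ 𝓗`. If `G` has a cluster editing set of size at most `k`,
then `k ≤ (2t+1)·(k - h(𝓗))`. -/
theorem stmt10 {V : Type*} [Fintype V] [DecidableEq V]
    (G : SimpleGraph V) (t k : ℕ) (ht : 1 ≤ t)
    (𝓗 : Finset (Finset V))
    (hdisj : ∀ W₁ ∈ 𝓗, ∀ W₂ ∈ 𝓗, W₁ ≠ W₂ → Disjoint W₁ W₂)
    (htau₁ : ∀ W ∈ 𝓗, 1 ≤ clusterEditNumOn G W)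
    (htau₂ : ∀ W ∈ 𝓗, clusterEditNumOn G W ≤ t)
    (hno : ∀ W ∈ 𝓗, ¬ ∃ S : Finset (Sym2 V), (∀ e ∈ S, ¬ e.IsDiag) ∧
      (∀ e ∈ S, ∀ v ∈ e, v ∈ W) ∧
      IsClusterGraph ((editEdges G ↑S).induce (W : Set V)) ∧
      S.card = clusterEditNumOn G W ∧
      (∀ (u : V) (hu : u ∈ (W : Set V)) (v : V) (hv : v ∈ (W : Set V)),
        ((editEdges G ↑S).induce (W : Set V)).Reachable ⟨u, hu⟩ ⟨v, hv⟩ →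
          G.neighborSet u \ ↑W = G.neighborSet v \ ↑W) ∧
      (∀ (u : V) (hu : u ∈ (W : Set V)) (v : V) (hv : v ∈ (W : Set V)),
        ¬ ((editEdges G ↑S).induce (W : Set V)).Reachable ⟨u, hu⟩ ⟨v, hv⟩ →
          G.neighborSet u ∩ G.neighborSet v ⊆ ↑W))
    (hsol : ∃ S : Finset (Sym2 V), IsClusterEditingSet G S ∧ S.card ≤ k) :
    (k : ℤ) ≤ (2 * (t : ℤ) + 1) * ((k : ℤ) - ∑ W ∈ 𝓗, (clusterEditNumOn G W : ℤ)) := by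
  classical
  obtain ⟨S, hS, hSk⟩ := hsol
  have key : ∀ W ∈ 𝓗, 2 * clusterEditNumOn G W + 1 ≤ ∑ e ∈ S, (e.toFinset ∩ W).card := by
    intro W hW
    have hτ := clusterEditNumOn_le hS W
    have hcount := two_mul_card_filter_add_card_filter_le hS.1 W
    by_contra! hlt
    have hcross : (S.filter fun e => (∃ v ∈ e, v ∈ W) ∧ ∃ v ∈ e, v ∉ W) = ∅ :=
      Finset.card_eq_zero.1 (by omega)
    refine hno W hW ⟨S.filter fun e => ∀ v ∈ e, v ∈ W,
      fun e he => hS.1 e (Finset.mem_filter.1 he).1,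
      fun e he => (Finset.mem_filter.1 he).2, ?_, by omega, ?_⟩
    all_goals rw [induce_editEdges_filter]
    · exact hS.2.induce _
    · refine hS.2.neighborSet_conditions fun u hu x hx hux => ?_
      exact Finset.filter_eq_empty_iff.1 hcross hux
        ⟨⟨u, Sym2.mem_mk_left u x, hu⟩, x, Sym2.mem_mk_right u x, hx⟩
  have hpack : 2 * ∑ W ∈ 𝓗, clusterEditNumOn G W + 𝓗.card ≤ 2 * S.card := by
    calc 2 * ∑ W ∈ 𝓗, clusterEditNumOn G W + 𝓗.card
        = ∑ W ∈ 𝓗, (2 * clusterEditNumOn G W + 1) := by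
          simp [Finset.sum_add_distrib, Finset.mul_sum]
      _ ≤ _ := Finset.sum_le_sum key
      _ ≤ _ := sum_sum_card_toFinset_inter_le hdisj
  have hsum : ∑ W ∈ 𝓗, clusterEditNumOn G W ≤ 𝓗.card * t :=
    Finset.sum_le_card_nsmul _ _ _ htau₂
  rw [← Nat.cast_sum]
  generalize ∑ W ∈ 𝓗, clusterEditNumOn G W = h at hpack hsum ⊢
  zify at hpack hsum hSk
  nlinarith [mul_le_mul_of_nonneg_left (hpack.trans (by linarith : 2 * (S.card : ℤ) ≤ 2 * k))
    (Int.natCast_nonneg t)]
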